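/- For every integer k ≥ 2 and every constant γ > 0 there exist constants c₁, c₂ > 0 and n₀ ∈ ℕ such that for all n ≥ n₀ with k ∣ n, every k-graph G on n vertices with δ(G) ≥ (1/2 + γ)n contains at least exp((1 − 1/k) n ln n − c₂ n) and at most exp((1 − 1/k) n ln n − c₁ n) perfect matchings. -/

import Mathlib

open scoped Classical

/-- The set of perfect matchings of the hypergraph on vertex set `Fin n` with edge set
`E`: collections of pairwise disjoint edges covering every vertex. -/
noncomputable def perfectMatchings (n : ℕ) (E : Finset (Finset (Fin n))) :
    Finset (Finset (Finset (Fin n))) :=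
  E.powerset.filter (fun M =>
    (M : Set (Finset (Fin n))).PairwiseDisjoint id ∧ M.biUnion id = Finset.univ)

open Finset in
/-- One switching step: a uniformly random value outside the exposed positions `W` hits a small
set with small probability. -/
lemma card_filter_mem_mul_le {P V : Type*} [Fintype P] [DecidableEq P] [DecidableEq V] (W : Finset P)
    (p : P) (A : Finset (P ≃ V)) (F : (P ≃ V) → Finset V) (d : ℝ)
    (hd : ∀ σ ∈ A, ((F σ).card : ℝ) ≤ d)
    (hA : ∀ σ ∈ A, ∀ q ∉ W, (Equiv.swap p q).trans σ ∈ A)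
    (hF : ∀ σ ∈ A, ∀ q ∉ W, F ((Equiv.swap p q).trans σ) = F σ) :
    ((A.filter (fun σ => σ p ∈ F σ)).card : ℝ) * (Wᶜ.card : ℝ) ≤ d * A.card := by
  have h1 : ∀ q ∈ Wᶜ, (A.filter (fun σ => σ p ∈ F σ)).card ≤
      (A.filter (fun σ => σ q ∈ F σ)).card := by
    intro q hq
    rw [mem_compl] at hq
    refine card_le_card_of_injOn (fun σ => (Equiv.swap p q).trans σ) ?_ ?_
    · intro σ hσ
      simp only [coe_filter, Set.mem_ofPred_eq] at hσ ⊢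
      refine ⟨hA σ hσ.1 q hq, ?_⟩
      rw [hF σ hσ.1 q hq]
      simpa using hσ.2
    · intro σ _ τ _ h
      ext x
      simpa using congrArg (fun e : P ≃ V => e (Equiv.swap p q x)) h
  have h2 : ∑ q ∈ Wᶜ, (A.filter (fun σ => σ q ∈ F σ)).card =
      ∑ σ ∈ A, (Wᶜ.filter (fun q => σ q ∈ F σ)).card :=
    (sum_card_bipartiteAbove_eq_sum_card_bipartiteBelow (s := A) (t := Wᶜ)
      (fun σ q => σ q ∈ F σ)).symm
  have h3 : ∀ σ ∈ A, ((Wᶜ.filter (fun q => σ q ∈ F σ)).card : ℝ) ≤ d := by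
    intro σ hσ
    refine le_trans ?_ (hd σ hσ)
    exact_mod_cast card_le_card_of_injOn σ (fun q hq => by simpa using (mem_filter.1 hq).2)
      σ.injective.injOn
  have h4 := sum_le_sum h1
  rw [h2, sum_const, smul_eq_mul] at h4
  have h5 := sum_le_sum h3
  rw [sum_const, nsmul_eq_mul] at h5
  have h6 : ((Wᶜ.card * (A.filter (fun σ => σ p ∈ F σ)).card : ℕ) : ℝ) ≤
      ((∑ σ ∈ A, (Wᶜ.filter (fun q => σ q ∈ F σ)).card : ℕ) : ℝ) := by exact_mod_cast h4
  push_cast at h6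
  linarith

open Finset in
/-- If the value at every position of `S` must lie in a set of size at most `d` determined by the
values at the positions in `Q`, then few bijections qualify. -/
lemma card_forall_mem_mul_pow_le {P V : Type*} [Fintype P] [Fintype V] [DecidableEq P] [DecidableEq V] (Q S : Finset P)
    (hQS : Disjoint Q S) (F : P → (P ≃ V) → Finset V) (d : ℝ) (m : ℕ)
    (hm : m + Q.card + S.card ≤ Fintype.card P)
    (hd : ∀ p σ, ((F p σ).card : ℝ) ≤ d)
    (hF : ∀ p ∈ S, ∀ σ τ : P ≃ V, (∀ q ∈ Q, σ q = τ q) → F p σ = F p τ) :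
    ((univ.filter (fun σ : P ≃ V => ∀ p ∈ S, σ p ∈ F p σ)).card : ℝ) * (m : ℝ) ^ S.card ≤
      d ^ S.card * (Fintype.card (P ≃ V) : ℝ) := by
  induction S using Finset.induction_on with
  | empty => simp [Finset.card_univ]
  | insert a S ha ih =>
    rw [card_insert_of_notMem ha] at hm
    rw [disjoint_insert_right] at hQS
    have ih := ih hQS.2 (by omega) (fun p hp => hF p (mem_insert_of_mem hp))
    set A := univ.filter (fun σ : P ≃ V => ∀ p ∈ S, σ p ∈ F p σ) with hAdef
    have hagree : ∀ q ∉ Q ∪ S, ∀ σ : P ≃ V, ∀ x ∈ Q ∪ S, ((Equiv.swap a q).trans σ) x = σ x := by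
      intro q hq σ x hx
      have h1 : x ≠ q := fun h => hq (h ▸ hx)
      have h2 : x ≠ a := by
        rintro rfl
        rcases mem_union.1 hx with h | h
        · exact hQS.1 h
        · exact ha h
      simp [Equiv.swap_apply_of_ne_of_ne h2 h1]
    have hinv : ∀ p ∈ insert a S, ∀ σ : P ≃ V, ∀ q ∉ Q ∪ S,
        F p ((Equiv.swap a q).trans σ) = F p σ := fun p hp σ q hq =>
      hF p hp _ _ fun x hx => hagree q hq σ x (mem_union_left _ hx)
    have key := card_filter_mem_mul_le (Q ∪ S) a A (F a) d (fun σ _ => hd a σ)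
      (by
        intro σ hσ q hq
        simp only [hAdef, mem_filter, mem_univ, true_and] at hσ ⊢
        intro p hp
        rw [hagree q hq σ p (mem_union_right _ hp), hinv p (mem_insert_of_mem hp) σ q hq]
        exact hσ p hp)
      (fun σ _ q hq => hinv a (mem_insert_self _ _) σ q hq)
    have heq : univ.filter (fun σ : P ≃ V => ∀ p ∈ insert a S, σ p ∈ F p σ) =
        A.filter (fun σ => σ a ∈ F a σ) := by
      ext σ
      simp [hAdef, and_comm]
    have hmc : (m : ℝ) ≤ ((Q ∪ S)ᶜ.card : ℝ) := by
      have := card_union_le Q S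
      rw [card_compl]
      exact_mod_cast (by omega)
    rw [heq, card_insert_of_notMem ha]
    have hA0 : (0 : ℝ) ≤ (A.filter (fun σ => σ a ∈ F a σ)).card := Nat.cast_nonneg _
    rcases isEmpty_or_nonempty (P ≃ V) with he | ⟨⟨σ₀⟩⟩
    · have : A.filter (fun σ => σ a ∈ F a σ) = ∅ := by
        ext σ
        exact he.elim σ
      simp [this]
    have hd0 : 0 ≤ d := (Nat.cast_nonneg _).trans (hd a σ₀)
    calc ((A.filter (fun σ => σ a ∈ F a σ)).card : ℝ) * (m : ℝ) ^ (S.card + 1)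
        = ((A.filter (fun σ => σ a ∈ F a σ)).card * (m : ℝ)) * (m : ℝ) ^ S.card := by ring
      _ ≤ ((A.filter (fun σ => σ a ∈ F a σ)).card * ((Q ∪ S)ᶜ.card : ℝ)) * (m : ℝ) ^ S.card := by
        gcongr
      _ ≤ (d * A.card) * (m : ℝ) ^ S.card := by gcongr
      _ = d * (A.card * (m : ℝ) ^ S.card) := by ring
      _ ≤ d * (d ^ S.card * (Fintype.card (P ≃ V) : ℝ)) := by gcongr
      _ = d ^ (S.card + 1) * (Fintype.card (P ≃ V) : ℝ) := by ring

open Finset in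
/-- A tail bound from factorial moments. -/
lemma card_tail_mul_pow_le {J Ω : Type*} [Fintype J] [Fintype Ω] (B : J → Ω → Prop)
    (r t : ℕ) (m d : ℝ) (hm : 0 ≤ m) (hd : 0 ≤ d)
    (h : ∀ S : Finset J, S.card = r →
      ((univ.filter (fun ω => ∀ j ∈ S, B j ω)).card : ℝ) * m ^ r ≤ d ^ r * Fintype.card Ω) :
    ((univ.filter (fun ω => t ≤ (univ.filter (fun j => B j ω)).card)).card : ℝ) *
      (((t + 1 - r : ℕ) : ℝ) * m) ^ r ≤ (Fintype.card J * d) ^ r * Fintype.card Ω := by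
  set bad := univ.filter (fun ω => t ≤ (univ.filter (fun j => B j ω)).card) with hbad
  have h1 : bad.card * t.choose r ≤
      ∑ S ∈ univ.powersetCard r, (univ.filter (fun ω => ∀ j ∈ S, B j ω)).card := by
    calc bad.card * t.choose r
        ≤ ∑ ω ∈ bad, ((univ.powersetCard r).filter (fun S : Finset J => ∀ j ∈ S, B j ω)).card := by
          rw [← smul_eq_mul, ← sum_const]
          refine sum_le_sum fun ω hω => ?_
          have hω' : t ≤ (univ.filter (fun j => B j ω)).card := (mem_filter.1 hω).2
          refine (Nat.choose_le_choose r hω').trans ?_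
          rw [← card_powersetCard]
          refine card_le_card fun S hS => ?_
          rw [mem_powersetCard] at hS
          simp only [mem_filter, mem_powersetCard, subset_univ, true_and]
          exact ⟨hS.2, fun j hj => (mem_filter.1 (hS.1 hj)).2⟩
      _ = ∑ S ∈ univ.powersetCard r, (bad.filter (fun ω => ∀ j ∈ S, B j ω)).card :=
          sum_card_bipartiteAbove_eq_sum_card_bipartiteBelow
            (s := bad) (t := univ.powersetCard r) (fun ω (S : Finset J) => ∀ j ∈ S, B j ω)
      _ ≤ _ := sum_le_sum fun S _ => card_le_card (filter_subset_filter _ (subset_univ _))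
  have h2 : ((∑ S ∈ univ.powersetCard r,
      (univ.filter (fun ω => ∀ j ∈ S, B j ω)).card : ℕ) : ℝ) * m ^ r ≤
      (Fintype.card J).choose r * (d ^ r * Fintype.card Ω) := by
    push_cast
    rw [sum_mul]
    refine (sum_le_sum (g := fun _ => d ^ r * (Fintype.card Ω : ℝ))
      fun S hS => h S (mem_powersetCard.1 hS).2).trans ?_
    rw [sum_const, card_powersetCard, nsmul_eq_mul, card_univ]
  have h3 : ((t + 1 - r : ℕ) : ℝ) ^ r ≤ r.factorial * t.choose r := by
    have := Nat.pow_sub_le_descFactorial t r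
    rw [Nat.descFactorial_eq_factorial_mul_choose] at this
    exact_mod_cast this
  have h4 : (r.factorial : ℝ) * (Fintype.card J).choose r ≤ (Fintype.card J : ℝ) ^ r := by
    have := Nat.descFactorial_le_pow (Fintype.card J) r
    rw [Nat.descFactorial_eq_factorial_mul_choose] at this
    exact_mod_cast this
  have h5 : (bad.card : ℝ) * t.choose r * m ^ r ≤
      (Fintype.card J).choose r * (d ^ r * Fintype.card Ω) := by
    refine le_trans ?_ h2
    have : (bad.card : ℝ) * t.choose r ≤ ((∑ S ∈ univ.powersetCard r,
      (univ.filter (fun ω => ∀ j ∈ S, B j ω)).card : ℕ) : ℝ) := by exact_mod_cast h1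
    gcongr
  calc (bad.card : ℝ) * (((t + 1 - r : ℕ) : ℝ) * m) ^ r
      = bad.card * (((t + 1 - r : ℕ) : ℝ) ^ r * m ^ r) := by rw [mul_pow]
    _ ≤ bad.card * ((r.factorial * t.choose r) * m ^ r) := by gcongr
    _ = r.factorial * (bad.card * t.choose r * m ^ r) := by ring
    _ ≤ r.factorial * ((Fintype.card J).choose r * (d ^ r * Fintype.card Ω)) := by gcongr
    _ = (r.factorial * (Fintype.card J).choose r) * (d ^ r * Fintype.card Ω) := by ring
    _ ≤ (Fintype.card J : ℝ) ^ r * (d ^ r * Fintype.card Ω) := by gcongr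
    _ = _ := by rw [mul_pow]; ring

open Finset in
/-- A dense bipartite graph has almost as many perfect matchings as the complete one. Both sides
are indexed by permutations `p.1`, `p.2`, and `A` is the set of indices required to be matched. -/
lemma pow_mul_factorial_sq_le_card_matchings {I : Type*} [Fintype I] [DecidableEq I] (R : I → I → Prop)
    (κ : ℝ) (hκ : 0 ≤ κ)
    (hrow : ∀ i, (1 + κ) / 2 * (Fintype.card I : ℝ) ≤ (univ.filter (fun j => R i j)).card)
    (hcol : ∀ j, (1 + κ) / 2 * (Fintype.card I : ℝ) ≤ (univ.filter (fun i => R i j)).card)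
    (A : Finset I) :
    (κ / 2) ^ A.card * ((Fintype.card I).factorial : ℝ) ^ 2 ≤
      (univ.filter (fun p : Equiv.Perm I × Equiv.Perm I =>
        ∀ i ∈ A, R (p.1 i) (p.2 i))).card := by
  induction A using Finset.induction_on with
  | empty => simp [Finset.card_univ, Fintype.card_perm, sq]
  | insert a A ha ih =>
    set T := univ.filter (fun p : Equiv.Perm I × Equiv.Perm I =>
      ∀ i ∈ A, R (p.1 i) (p.2 i)) with hT
    set T' := univ.filter (fun p : Equiv.Perm I × Equiv.Perm I =>
      ∀ i ∈ insert a A, R (p.1 i) (p.2 i)) with hT'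
    have hne : ∀ i ∈ A, i ≠ a := fun i hi h => ha (h ▸ hi)
    have hinj₂ : ∀ l : I, Function.Injective
        (fun p : Equiv.Perm I × Equiv.Perm I => (p.1, p.2 * Equiv.swap a l)) := by
      rintro l ⟨p, q⟩ ⟨p', q'⟩ h
      simpa using h
    have hinj₁ : ∀ l : I, Function.Injective
        (fun p : Equiv.Perm I × Equiv.Perm I => (p.1 * Equiv.swap a l, p.2)) := by
      rintro l ⟨p, q⟩ ⟨p', q'⟩ h
      simpa using h
    have hX₁ : ∀ l ∈ Aᶜ, (T.filter (fun p => R (p.1 a) (p.2 l))).card ≤ T'.card := by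
      intro l hl
      rw [mem_compl] at hl
      refine card_le_card_of_injOn _ (fun p hp => ?_) (hinj₂ l).injOn
      simp only [hT, hT', mem_filter, mem_univ, true_and, coe_filter, Set.mem_ofPred_eq,
        mem_insert, forall_eq_or_imp] at hp ⊢
      refine ⟨by simpa using hp.2, fun i hi => ?_⟩
      have : i ≠ l := fun h => hl (h ▸ hi)
      simpa [Equiv.swap_apply_of_ne_of_ne (hne i hi) this] using hp.1 i hi
    have hX₂ : ∀ l ∈ Aᶜ, (T.filter (fun p => R (p.1 l) (p.2 a))).card ≤ T'.card := by
      intro l hl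
      rw [mem_compl] at hl
      refine card_le_card_of_injOn _ (fun p hp => ?_) (hinj₁ l).injOn
      simp only [hT, hT', mem_filter, mem_univ, true_and, coe_filter, Set.mem_ofPred_eq,
        mem_insert, forall_eq_or_imp] at hp ⊢
      refine ⟨by simpa using hp.2, fun i hi => ?_⟩
      have : i ≠ l := fun h => hl (h ▸ hi)
      simpa [Equiv.swap_apply_of_ne_of_ne (hne i hi) this] using hp.1 i hi
    have hX₃ : ∀ l ∈ A, (T.filter (fun p => R (p.1 a) (p.2 l) ∧ R (p.1 l) (p.2 a))).card
        ≤ T'.card := by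
      intro l hl
      refine card_le_card_of_injOn _ (fun p hp => ?_) (hinj₂ l).injOn
      simp only [hT, hT', mem_filter, mem_univ, true_and, coe_filter, Set.mem_ofPred_eq,
        mem_insert, forall_eq_or_imp] at hp ⊢
      refine ⟨by simpa using hp.2.1, fun i hi => ?_⟩
      by_cases h : i = l
      · subst h
        simpa using hp.2.2
      · simpa [Equiv.swap_apply_of_ne_of_ne (hne i hi) h] using hp.1 i hi
    have hpt : ∀ p ∈ T, (1 + κ) * (Fintype.card I : ℝ) ≤
        (((A.filter (fun l => R (p.1 a) (p.2 l) ∧ R (p.1 l) (p.2 a))).card + A.card +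
          (Aᶜ.filter (fun l => R (p.1 a) (p.2 l))).card +
          (Aᶜ.filter (fun l => R (p.1 l) (p.2 a))).card : ℕ) : ℝ) := by
      intro p _
      have e₁ : (univ.filter (fun j => R (p.1 a) j)).card =
          (univ.filter (fun l => R (p.1 a) (p.2 l))).card :=
        (card_equiv p.2 (by simp)).symm
      have e₂ : (univ.filter (fun i => R i (p.2 a))).card =
          (univ.filter (fun l => R (p.1 l) (p.2 a))).card :=
        (card_equiv p.1 (by simp)).symm
      have s₁ : (univ.filter (fun l => R (p.1 a) (p.2 l))).card =
          (A.filter (fun l => R (p.1 a) (p.2 l))).card +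
          (Aᶜ.filter (fun l => R (p.1 a) (p.2 l))).card := by
        rw [← card_union_of_disjoint (disjoint_filter_filter disjoint_compl_right),
          ← filter_union, union_compl]
      have s₂ : (univ.filter (fun l => R (p.1 l) (p.2 a))).card =
          (A.filter (fun l => R (p.1 l) (p.2 a))).card +
          (Aᶜ.filter (fun l => R (p.1 l) (p.2 a))).card := by
        rw [← card_union_of_disjoint (disjoint_filter_filter disjoint_compl_right),
          ← filter_union, union_compl]
      have s₃ := card_union_add_card_inter (A.filter (fun l => R (p.1 a) (p.2 l)))
        (A.filter (fun l => R (p.1 l) (p.2 a)))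
      rw [← filter_and, ← filter_or] at s₃
      have s₄ := card_filter_le A (fun l => R (p.1 a) (p.2 l) ∨ R (p.1 l) (p.2 a))
      have hr := hrow (p.1 a)
      have hc := hcol (p.2 a)
      rw [e₁, s₁] at hr
      rw [e₂, s₂] at hc
      have h := add_le_add hr hc
      refine le_trans (by linarith) (h.trans ?_)
      exact_mod_cast (by omega)
    have hsum := sum_le_sum hpt
    rw [sum_const, nsmul_eq_mul, ← Nat.cast_sum] at hsum
    have hnat : ∑ p ∈ T, ((A.filter (fun l => R (p.1 a) (p.2 l) ∧ R (p.1 l) (p.2 a))).card +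
        A.card + (Aᶜ.filter (fun l => R (p.1 a) (p.2 l))).card +
        (Aᶜ.filter (fun l => R (p.1 l) (p.2 a))).card) ≤
        A.card * T'.card + T.card * A.card + Aᶜ.card * T'.card + Aᶜ.card * T'.card := by
      rw [sum_add_distrib, sum_add_distrib, sum_add_distrib, sum_const, smul_eq_mul]
      gcongr
      · refine (sum_card_bipartiteAbove_eq_sum_card_bipartiteBelow (s := T) (t := A)
          (fun p l => R (p.1 a) (p.2 l) ∧ R (p.1 l) (p.2 a))).trans_le ?_
        exact sum_le_card_nsmul _ _ _ hX₃
      · refine (sum_card_bipartiteAbove_eq_sum_card_bipartiteBelow (s := T) (t := Aᶜ)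
          (fun p l => R (p.1 a) (p.2 l))).trans_le ?_
        exact sum_le_card_nsmul _ _ _ hX₁
      · refine (sum_card_bipartiteAbove_eq_sum_card_bipartiteBelow (s := T) (t := Aᶜ)
          (fun p l => R (p.1 l) (p.2 a))).trans_le ?_
        exact sum_le_card_nsmul _ _ _ hX₂
    have hreal := hsum.trans (Nat.cast_le.2 hnat)
    push_cast at hreal
    have hN : (A.card : ℝ) + Aᶜ.card = Fintype.card I := by exact_mod_cast card_add_card_compl A
    have hNpos : (0 : ℝ) < Fintype.card I := by exact_mod_cast Fintype.card_pos_iff.2 ⟨a⟩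
    have hstep : κ / 2 * (T.card : ℝ) ≤ T'.card := by
      have h0 : (0 : ℝ) ≤ Aᶜ.card * T.card := by positivity
      have h0' : (0 : ℝ) ≤ A.card * T'.card := by positivity
      have : (Fintype.card I : ℝ) * (κ * T.card) ≤ Fintype.card I * (2 * T'.card) := by
        rw [← hN] at hreal ⊢
        linarith
      have := le_of_mul_le_mul_left this hNpos
      linarith
    rw [card_insert_of_notMem ha]
    calc (κ / 2) ^ (A.card + 1) * ((Fintype.card I).factorial : ℝ) ^ 2
        = κ / 2 * ((κ / 2) ^ A.card * ((Fintype.card I).factorial : ℝ) ^ 2) := by ring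
      _ ≤ κ / 2 * T.card := by gcongr
      _ ≤ T'.card := hstep

/-- The set of values of `σ` on the `i`-th row. -/
noncomputable def rowSet {I C V : Type*} [Fintype C] [DecidableEq V] (σ : I × C ≃ V) (i : I) : Finset V :=
  Finset.univ.image (fun c => σ (i, c))

lemma mem_rowSet {I C V : Type*} [Fintype C] [DecidableEq V] {σ : I × C ≃ V} {i : I} {x : V} :
    x ∈ rowSet σ i ↔ ∃ c, σ (i, c) = x := by
  simp [rowSet]

lemma apply_mem_rowSet {I C V : Type*} [Fintype C] [DecidableEq V] {σ : I × C ≃ V} {i j : I} {c : C} :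
    σ (i, c) ∈ rowSet σ j ↔ i = j := by
  simp [rowSet, eq_comm]

/-- The partition of `V` into the rows of `σ`. -/
noncomputable def rowPartition {I C V : Type*} [Fintype I] [Fintype C] [DecidableEq V]
    (σ : I × C ≃ V) :
    Finset (Finset V) :=
  Finset.univ.image (rowSet σ)

open Finset in
/-- Every row partition comes from the same number of bijections. -/
lemma card_filter_rowPartition_eq {I C V : Type*} [Fintype I] [Fintype C] [Nonempty C] [Fintype V]
    [DecidableEq I] [DecidableEq C] [DecidableEq V]
    (σ₀ : I × C ≃ V) :
    (univ.filter (fun σ : I × C ≃ V => rowPartition σ = rowPartition σ₀)).card =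
      (Fintype.card I).factorial * (Fintype.card C).factorial ^ Fintype.card I := by
  set Φ : Equiv.Perm I × (I → Equiv.Perm C) → (I × C ≃ V) :=
    fun p => (Equiv.prodShear p.1 p.2).trans σ₀ with hΦ
  have hinj : Function.Injective Φ := by
    rintro ⟨π, f⟩ ⟨π', f'⟩ h
    have h' : ∀ i c, π i = π' i ∧ f i c = f' i c := by
      intro i c
      simpa [hΦ] using congrArg (fun e : I × C ≃ V => e (i, c)) h
    have h1 : π = π' := Equiv.ext fun i => (h' i (Classical.arbitrary C)).1
    have h2 : f = f' := funext fun i => Equiv.ext fun c => (h' i c).2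
    rw [h1, h2]
  have himg : univ.filter (fun σ : I × C ≃ V => rowPartition σ = rowPartition σ₀) =
      univ.image Φ := by
    ext σ
    simp only [mem_filter, mem_univ, true_and, mem_image]
    constructor
    · intro h
      have h1 : ∀ i, ∃ j, rowSet σ₀ j = rowSet σ i := by
        intro i
        have : rowSet σ i ∈ rowPartition σ₀ := h ▸ mem_image_of_mem _ (mem_univ i)
        simpa [rowPartition] using this
      choose π hπ using h1
      have h2 : ∀ i c, ∃ c', σ₀ (π i, c') = σ (i, c) := by
        intro i c
        have : σ (i, c) ∈ rowSet σ₀ (π i) := by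
          rw [hπ]
          exact apply_mem_rowSet.2 rfl
        exact mem_rowSet.1 this
      choose f hf using h2
      have hπi : Function.Injective π := by
        intro i i' hii
        have : rowSet σ i = rowSet σ i' := by rw [← hπ, ← hπ, hii]
        have h3 : σ (i, Classical.arbitrary C) ∈ rowSet σ i' := this ▸ apply_mem_rowSet.2 rfl
        exact apply_mem_rowSet.1 h3
      have hfi : ∀ i, Function.Injective (f i) := by
        intro i c c' hcc
        have : σ (i, c) = σ (i, c') := by rw [← hf, ← hf, hcc]
        simpa using this
      refine ⟨(Equiv.ofBijective π (Finite.injective_iff_bijective.1 hπi),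
        fun i => Equiv.ofBijective (f i) (Finite.injective_iff_bijective.1 (hfi i))), ?_⟩
      ext ⟨i, c⟩
      simp [hΦ, hf]
    · rintro ⟨⟨π, f⟩, rfl⟩
      have : ∀ i, rowSet (Φ (π, f)) i = rowSet σ₀ (π i) := by
        intro i
        ext x
        simp only [mem_rowSet, hΦ, Equiv.trans_apply, Equiv.prodShear_apply]
        exact ((f i).surjective.exists (p := fun c => σ₀ (π i, c) = x)).symm
      ext e
      simp only [rowPartition, mem_image, mem_univ, true_and, this]
      exact (π.surjective.exists (p := fun i => rowSet σ₀ i = e)).symm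
  rw [himg, card_image_of_injective _ hinj, card_univ, Fintype.card_prod, Fintype.card_perm,
    Fintype.card_fun, Fintype.card_perm]

open Finset in
lemma rowPartition_mem_perfectMatchings {N k n : ℕ} {E : Finset (Finset (Fin n))}
    {σ : Fin N × Fin k ≃ Fin n} (h : ∀ i, rowSet σ i ∈ E) :
    rowPartition σ ∈ perfectMatchings n E := by
  simp only [perfectMatchings, mem_filter, mem_powerset]
  refine ⟨?_, ?_, ?_⟩
  · intro e he
    obtain ⟨i, -, rfl⟩ := mem_image.1 he
    exact h i
  · intro e he e' he' hne
    obtain ⟨i, -, rfl⟩ := mem_image.1 (mem_coe.1 he)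
    obtain ⟨j, -, rfl⟩ := mem_image.1 (mem_coe.1 he')
    refine disjoint_left.2 fun x hx hx' => hne ?_
    obtain ⟨c, rfl⟩ := mem_rowSet.1 hx
    rw [apply_mem_rowSet.1 hx']
  · refine eq_univ_of_forall fun x => ?_
    obtain ⟨⟨i, c⟩, rfl⟩ := σ.surjective x
    exact mem_biUnion.2 ⟨_, mem_image_of_mem _ (mem_univ i), apply_mem_rowSet.2 rfl⟩

open Finset in
lemma exists_rowPartition_eq {N k n : ℕ} (hk : 0 < k) (hn : n = N * k)
    {E : Finset (Finset (Fin n))} (hE : ∀ e ∈ E, e.card = k) {M : Finset (Finset (Fin n))}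
    (hM : M ∈ perfectMatchings n E) :
    ∃ σ : Fin N × Fin k ≃ Fin n, rowPartition σ = M := by
  simp only [perfectMatchings, mem_filter, mem_powerset] at hM
  obtain ⟨hME, hdisj, hcover⟩ := hM
  have hcard : M.card = N := by
    have h1 : (M.biUnion id).card = ∑ e ∈ M, e.card := card_biUnion hdisj
    rw [hcover, card_univ, Fintype.card_fin, sum_const_nat (fun e he => hE e (hME he))] at h1
    exact Nat.eq_of_mul_eq_mul_right hk (h1.symm.trans hn)
  let g : M ≃ Fin N := M.equivFinOfCardEq hcard
  let f : ∀ e : M, (e : Finset (Fin n)) ≃ Fin k :=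
    fun e => (e : Finset (Fin n)).equivFinOfCardEq (hE e (hME e.2))
  let s : Fin N × Fin k → Fin n := fun p => ((f (g.symm p.1)).symm p.2 : Fin n)
  have hs : Function.Surjective s := by
    intro x
    have hx : x ∈ M.biUnion id := hcover ▸ mem_univ x
    obtain ⟨e, he, hxe⟩ := mem_biUnion.1 hx
    refine ⟨(g ⟨e, he⟩, f (g.symm (g ⟨e, he⟩)) ⟨x, ?_⟩), ?_⟩
    · rw [g.symm_apply_apply]
      exact hxe
    · simp only [s, Equiv.symm_apply_apply]
  have hb : Function.Bijective s :=
    (Fintype.bijective_iff_surjective_and_card s).2 ⟨hs, by simp [hn]⟩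
  refine ⟨Equiv.ofBijective s hb, ?_⟩
  have hrow : ∀ i, rowSet (Equiv.ofBijective s hb) i = (g.symm i : Finset (Fin n)) := by
    intro i
    ext x
    simp only [mem_rowSet, Equiv.ofBijective_apply, s]
    constructor
    · rintro ⟨c, rfl⟩
      exact ((f (g.symm i)).symm c).2
    · intro hx
      exact ⟨f (g.symm i) ⟨x, hx⟩, by simp⟩
  ext e
  simp only [rowPartition, mem_image, mem_univ, true_and, hrow]
  constructor
  · rintro ⟨i, rfl⟩
    exact (g.symm i).2
  · intro he
    exact ⟨g ⟨e, he⟩, by simp⟩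

open Finset in
/-- Perfect matchings counted through the bijections all of whose rows are edges. -/
lemma card_rows_mem_eq {N k n : ℕ} (hk : 0 < k) (hn : n = N * k)
    {E : Finset (Finset (Fin n))} (hE : ∀ e ∈ E, e.card = k) :
    (univ.filter (fun σ : Fin N × Fin k ≃ Fin n => ∀ i, rowSet σ i ∈ E)).card =
      (perfectMatchings n E).card * (N.factorial * k.factorial ^ N) := by
  have : Nonempty (Fin k) := ⟨⟨0, hk⟩⟩
  rw [card_eq_sum_card_fiberwise (f := rowPartition) (t := perfectMatchings n E)
    (fun σ hσ => rowPartition_mem_perfectMatchings (mem_filter.1 (mem_coe.1 hσ)).2)]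
  refine sum_const_nat fun M hM => ?_
  obtain ⟨σ₀, rfl⟩ := exists_rowPartition_eq hk hn hE hM
  have hc := card_filter_rowPartition_eq σ₀
  rw [Fintype.card_fin, Fintype.card_fin] at hc
  rw [← hc]
  congr 1
  ext σ
  simp only [mem_filter, mem_univ, true_and, and_iff_right_iff_imp]
  intro h i
  have h1 : rowSet σ i ∈ rowPartition σ₀ := h ▸ mem_image_of_mem _ (mem_univ i)
  have h2 := (mem_powerset.1 (mem_filter.1 hM).1)
  exact h2 h1

open Finset in
/-- The edge candidate formed by the value at `(j, z)` and the values at the positions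
of row `i` other than `(i, z)`. -/
noncomputable def mixedRow {I C V : Type*} [Fintype C] [DecidableEq C] [DecidableEq V] (z : C) (σ : I × C ≃ V) (i j : I) :
    Finset V :=
  insert (σ (j, z)) ((univ.erase z).image (fun c => σ (i, c)))

open Finset in
lemma sum_card_mixedRow_le {I C V : Type*} [Fintype I] [Fintype C] [Fintype V]
    [DecidableEq I] [DecidableEq C] [DecidableEq V] (z : C)
    (E : Finset (Finset V)) :
    ∑ σ : I × C ≃ V, (univ.filter (fun p : Equiv.Perm I × Equiv.Perm I =>
        ∀ i, mixedRow z σ (p.1 i) (p.2 i) ∈ E)).card ≤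
      (Fintype.card I).factorial ^ 2 *
        (univ.filter (fun σ : I × C ≃ V => ∀ i, rowSet σ i ∈ E)).card := by
  have h := sum_card_bipartiteAbove_eq_sum_card_bipartiteBelow
    (s := (univ : Finset (I × C ≃ V))) (t := (univ : Finset (Equiv.Perm I × Equiv.Perm I)))
    (fun σ p => ∀ i, mixedRow z σ (p.1 i) (p.2 i) ∈ E)
  simp only [bipartiteAbove, bipartiteBelow] at h
  rw [h]
  refine (sum_le_card_nsmul _ _
    (univ.filter (fun σ : I × C ≃ V => ∀ i, rowSet σ i ∈ E)).card fun p _ => ?_).trans_eq ?_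
  · set tw : I × C ≃ I × C := Equiv.prodCongrLeft (fun c => if c = z then p.2 else p.1) with htw
    refine card_le_card_of_injOn (fun σ => tw.trans σ) (fun σ hσ => ?_) ?_
    · simp only [mem_univ, true_and, coe_filter, Set.mem_ofPred_eq] at hσ ⊢
      intro i
      have : rowSet (tw.trans σ) i = mixedRow z σ (p.1 i) (p.2 i) := by
        rw [rowSet, mixedRow, ← insert_erase (mem_univ z), image_insert, erase_insert_eq_erase,
          erase_idem]
        congr 1
        · simp [htw]
        · refine image_congr fun c hc => ?_
          have : c ≠ z := by simpa using hc
          simp [htw, this]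
      rw [this]
      exact hσ i
    · intro σ _ τ _ h
      ext x
      simpa using congrArg (fun e : I × C ≃ V => e (tw.symm x)) h
  · rw [card_univ, Fintype.card_prod, Fintype.card_perm, smul_eq_mul, sq]

open Finset in
lemma card_insert_notMem_le {V : Type*} [Fintype V] [DecidableEq V] {E : Finset (Finset V)} {k : ℕ}
    (hk : 0 < k) (hE : ∀ e ∈ E, e.card = k) {γ : ℝ} {S : Finset V} (hS : S.card = k - 1)
    (hdeg : (1 / 2 + γ) * (Fintype.card V : ℝ) ≤ ((E.filter (fun e => S ⊆ e)).card : ℝ)) :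
    ((univ.filter (fun x => insert x S ∉ E)).card : ℝ) ≤ (1 / 2 - γ) * Fintype.card V := by
  have h1 : (E.filter (fun e => S ⊆ e)).card ≤ (univ.filter (fun x => insert x S ∈ E)).card := by
    refine (card_le_card fun e he => ?_).trans
      (card_image_le (s := univ.filter (fun x => insert x S ∈ E)) (f := fun x => insert x S))
    rw [mem_filter] at he
    have h2 : (e \ S).card = 1 := by
      rw [card_sdiff_of_subset he.2, hE e he.1, hS]
      omega
    obtain ⟨x, hx⟩ := card_eq_one.1 h2
    have h3 : insert x S = e := by
      rw [insert_eq, ← hx, sdiff_union_of_subset he.2]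
    exact mem_image.2 ⟨x, by simp [h3, he.1], h3⟩
  have h4 := card_filter_add_card_filter_not (s := (univ : Finset V)) (fun x => insert x S ∈ E)
  rw [card_univ] at h4
  have h5 : ((univ.filter (fun x => insert x S ∈ E)).card : ℝ) +
      (univ.filter (fun x => insert x S ∉ E)).card = Fintype.card V := by exact_mod_cast h4
  have h6 : ((E.filter (fun e => S ⊆ e)).card : ℝ) ≤
      (univ.filter (fun x => insert x S ∈ E)).card := by exact_mod_cast h1
  linarith

section Tails

variable {I C V : Type*} [Fintype I] [Fintype C] [Fintype V]
  [DecidableEq I] [DecidableEq C] [DecidableEq V]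

open Finset in
lemma card_forall_mixedRow_notMem_right_le {z : C} {E : Finset (Finset V)} {d : ℝ}
    (hcod : ∀ S : Finset V, S.card = Fintype.card C - 1 →
      ((univ.filter (fun x => insert x S ∉ E)).card : ℝ) ≤ d)
    (i : I) (J : Finset I) (hJ : 0 < J.card) (m : ℕ)
    (hm : m + Fintype.card C * J.card ≤ Fintype.card I * Fintype.card C) :
    ((univ.filter (fun σ : I × C ≃ V => ∀ j ∈ J, mixedRow z σ i j ∉ E)).card : ℝ) *
      (m : ℝ) ^ J.card ≤ d ^ J.card * (Fintype.card (I × C ≃ V) : ℝ) := by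
  have hinjS : Function.Injective (fun j : I => (j, z)) := fun _ _ h => (Prod.ext_iff.1 h).1
  have hinjQ : Function.Injective (fun c : C => (i, c)) := fun _ _ h => (Prod.ext_iff.1 h).2
  have hSc : (J.image (fun j => (j, z))).card = J.card := card_image_of_injective _ hinjS
  have hQc : ((univ.erase z).image (fun c => (i, c))).card = Fintype.card C - 1 := by
    rw [card_image_of_injective _ hinjQ, card_erase_of_mem (mem_univ z), card_univ]
  have hC : 0 < Fintype.card C := Fintype.card_pos_iff.2 ⟨z⟩
  have key := card_forall_mem_mul_pow_le (V := V) ((univ.erase z).image (fun c => (i, c)))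
    (J.image (fun j => (j, z)))
    (by
      refine disjoint_left.2 fun p hp hp' => ?_
      obtain ⟨c, hc, rfl⟩ := mem_image.1 hp
      obtain ⟨j, -, hj⟩ := mem_image.1 hp'
      exact (mem_erase.1 hc).1 (Prod.ext_iff.1 hj).2.symm)
    (fun _ σ => univ.filter (fun x => insert x ((univ.erase z).image (fun c => σ (i, c))) ∉ E))
    d m
    (by
      rw [hSc, hQc, Fintype.card_prod]
      obtain ⟨c, hc⟩ := Nat.exists_eq_add_of_lt hC
      rw [hc] at hm ⊢
      have : c ≤ c * J.card := Nat.le_mul_of_pos_right c hJ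
      have h2 : (0 + c + 1) * J.card = c * J.card + J.card := by ring
      omega)
    (fun _ σ => hcod _ (by
      have hinj : Function.Injective (fun c : C => σ (i, c)) := σ.injective.comp hinjQ
      rw [card_image_of_injective _ hinj, card_erase_of_mem (mem_univ z), card_univ]))
    (fun _ _ σ τ h => by
      have : (univ.erase z).image (fun c => σ (i, c)) = (univ.erase z).image (fun c => τ (i, c)) :=
        image_congr fun c hc => h _ (mem_image_of_mem _ hc)
      simp only [this])
  rw [hSc] at key
  convert key using 4
  ext σ
  rw [mem_filter, mem_filter]
  simp [mixedRow]

open Finset in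
lemma card_forall_mixedRow_notMem_left_le {z o : C} (hzo : o ≠ z) {E : Finset (Finset V)} {d : ℝ}
    (hcod : ∀ S : Finset V, S.card = Fintype.card C - 1 →
      ((univ.filter (fun x => insert x S ∉ E)).card : ℝ) ≤ d)
    (j : I) (J : Finset I) (hJ : 0 < J.card) (m : ℕ)
    (hm : m + Fintype.card C * J.card ≤ Fintype.card I * Fintype.card C) :
    ((univ.filter (fun σ : I × C ≃ V => ∀ i ∈ J, mixedRow z σ i j ∉ E)).card : ℝ) *
      (m : ℝ) ^ J.card ≤ d ^ J.card * (Fintype.card (I × C ≃ V) : ℝ) := by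
  have hinjS : Function.Injective (fun i : I => (i, o)) := fun _ _ h => (Prod.ext_iff.1 h).1
  have hSc : (J.image (fun i => (i, o))).card = J.card := card_image_of_injective _ hinjS
  set D : Finset C := (univ.erase z).erase o with hD
  have hoz : o ∈ univ.erase z := mem_erase.2 ⟨hzo, mem_univ o⟩
  have hDc : D.card + 2 = Fintype.card C := by
    have h1 := card_erase_add_one hoz
    have h2 := card_erase_add_one (mem_univ z)
    rw [card_univ] at h2
    rw [← hD] at h1
    omega
  have hzD : z ∉ D := by simp [hD]
  have hoD : o ∉ D := by simp [hD]
  have hins : insert o D = univ.erase z := insert_erase hoz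
  have hQc : (insert (j, z) (J ×ˢ D)).card ≤ J.card * D.card + 1 :=
    (card_insert_le _ _).trans (by rw [card_product])
  have key := card_forall_mem_mul_pow_le (V := V) (insert (j, z) (J ×ˢ D))
    (J.image (fun i => (i, o)))
    (by
      refine disjoint_left.2 fun p hp hp' => ?_
      obtain ⟨i, -, rfl⟩ := mem_image.1 hp'
      rcases mem_insert.1 hp with h | h
      · exact hzo (Prod.ext_iff.1 h).2
      · exact hoD (mem_product.1 h).2)
    (fun p σ => univ.filter
      (fun x => insert x (insert (σ (j, z)) (D.image (fun c => σ (p.1, c)))) ∉ E))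
    d m
    (by
      rw [hSc, Fintype.card_prod]
      rw [← hDc] at hm ⊢
      have h2 : (D.card + 2) * J.card = J.card * D.card + 2 * J.card := by ring
      omega)
    (fun p σ => hcod _ (by
      rw [card_insert_of_notMem, card_image_of_injective]
      · omega
      · exact fun _ _ h => (Prod.ext_iff.1 (σ.injective h)).2
      · intro h
        obtain ⟨c, hc, h⟩ := mem_image.1 h
        exact hzD ((show c = z from (Prod.ext_iff.1 (σ.injective h)).2) ▸ hc)))
    (fun p hp σ τ h => by
      obtain ⟨i, hi, rfl⟩ := mem_image.1 hp
      have h1 : D.image (fun c => σ (i, c)) = D.image (fun c => τ (i, c)) :=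
        image_congr fun c hc => h _ (mem_insert_of_mem (mem_product.2 ⟨hi, hc⟩))
      simp only [h1, h _ (mem_insert_self _ _)])
  rw [hSc] at key
  have hmix : ∀ (σ : I × C ≃ V) (i : I), mixedRow z σ i j =
      insert (σ (i, o)) (insert (σ (j, z)) (D.image (fun c => σ (i, c)))) := by
    intro σ i
    rw [mixedRow, ← hins, image_insert, insert_comm]
  convert key using 4
  ext σ
  simp [hmix]

open Finset in
/-- If all codegrees exceed half, a positive proportion `(κ / 2) ^ N / 2` of the bijections has
only edges as rows. -/
lemma le_card_rows_mem {z o : C} (hzo : o ≠ z) {E : Finset (Finset V)} {d : ℝ} (hd : 0 ≤ d)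
    (hcod : ∀ S : Finset V, S.card = Fintype.card C - 1 →
      ((univ.filter (fun x => insert x S ∉ E)).card : ℝ) ≤ d)
    {κ : ℝ} (hκ : 0 ≤ κ) {t r m : ℕ} (hr : 0 < r) (ht : t = ⌈(1 - κ) / 2 * Fintype.card I⌉₊)
    (hm : m + Fintype.card C * r ≤ Fintype.card I * Fintype.card C)
    {q : ℝ} (hpos : 0 < ((t + 1 - r : ℕ) : ℝ) * m)
    (hq : Fintype.card I * d ≤ q * (((t + 1 - r : ℕ) : ℝ) * m))
    (hsmall : 4 * (Fintype.card I : ℝ) * q ^ r ≤ 1) :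
    (Fintype.card (I × C ≃ V) : ℝ) / 2 * (κ / 2) ^ Fintype.card I ≤
      (univ.filter (fun σ : I × C ≃ V => ∀ i, rowSet σ i ∈ E)).card := by
  set T : ℝ := (Fintype.card (I × C ≃ V) : ℝ) with hT
  set N : ℝ := (Fintype.card I : ℝ) with hN
  have htail : ∀ B : I → (I × C ≃ V) → Prop, (∀ S : Finset I, S.card = r →
      ((univ.filter (fun ω => ∀ j ∈ S, B j ω)).card : ℝ) * (m : ℝ) ^ r ≤ d ^ r * T) →
      ((univ.filter (fun ω => t ≤ (univ.filter (fun j => B j ω)).card)).card : ℝ) ≤ q ^ r * T := by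
    intro B hB
    have h1 := card_tail_mul_pow_le B r t m d (Nat.cast_nonneg _) hd
      (fun S hS => by
        have := hB S hS
        rw [hT] at this
        convert this)
    rw [← hT, ← hN] at h1
    have h2 : (N * d) ^ r ≤ (q * (((t + 1 - r : ℕ) : ℝ) * m)) ^ r :=
      pow_le_pow_left₀ (by positivity) hq r
    have h3 : ((univ.filter (fun ω => t ≤ (univ.filter (fun j => B j ω)).card)).card : ℝ) *
        (((t + 1 - r : ℕ) : ℝ) * m) ^ r ≤ (q ^ r * T) * (((t + 1 - r : ℕ) : ℝ) * m) ^ r := by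
      refine h1.trans ?_
      refine (mul_le_mul_of_nonneg_right h2 (hT ▸ Nat.cast_nonneg _)).trans_eq ?_
      rw [mul_pow q]
      ring
    exact le_of_mul_le_mul_right h3 (by positivity)
  set bad₁ : I → Finset (I × C ≃ V) := fun i => univ.filter (fun σ : I × C ≃ V =>
    t ≤ (univ.filter (fun j => mixedRow z σ i j ∉ E)).card) with hbad₁
  set bad₂ : I → Finset (I × C ≃ V) := fun j => univ.filter (fun σ : I × C ≃ V =>
    t ≤ (univ.filter (fun i => mixedRow z σ i j ∉ E)).card) with hbad₂
  have hb₁ : ∀ i, ((bad₁ i).card : ℝ) ≤ q ^ r * T := by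
    intro i
    have := htail (fun j σ => mixedRow z σ i j ∉ E) (fun S hS => by
      have := card_forall_mixedRow_notMem_right_le (z := z) hcod i S (hS ▸ hr) m (hS ▸ hm)
      rw [hS] at this
      convert this)
    convert this
  have hb₂ : ∀ j, ((bad₂ j).card : ℝ) ≤ q ^ r * T := by
    intro j
    have := htail (fun i σ => mixedRow z σ i j ∉ E) (fun S hS => by
      have := card_forall_mixedRow_notMem_left_le hzo hcod j S (hS ▸ hr) m (hS ▸ hm)
      rw [hS] at this
      convert this)
    convert this
  set bad := univ.biUnion bad₁ ∪ univ.biUnion bad₂ with hbad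
  have hbadc : (bad.card : ℝ) ≤ T / 2 := by
    have h1 : bad.card ≤ ∑ i, (bad₁ i).card + ∑ i, (bad₂ i).card :=
      (card_union_le _ _).trans (add_le_add card_biUnion_le card_biUnion_le)
    have h2 : ((∑ i, (bad₁ i).card + ∑ i, (bad₂ i).card : ℕ) : ℝ) ≤ 2 * N * (q ^ r * T) := by
      push_cast
      have e1 := sum_le_sum (s := univ) fun i _ => hb₁ i
      have e2 := sum_le_sum (s := univ) fun i _ => hb₂ i
      rw [sum_const, card_univ, nsmul_eq_mul] at e1 e2
      linarith
    have h3 : (bad.card : ℝ) ≤ 2 * N * (q ^ r * T) := le_trans (by exact_mod_cast h1) h2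
    have hT0 : 0 ≤ T := Nat.cast_nonneg _
    have h4 := mul_le_mul_of_nonneg_right hsmall hT0
    linarith
  have hgood : T / 2 ≤ (badᶜ.card : ℝ) := by
    have : (bad.card : ℝ) + badᶜ.card = T := by
      rw [hT]
      exact_mod_cast card_add_card_compl bad
    linarith
  have hper : ∀ σ ∈ badᶜ, (κ / 2) ^ Fintype.card I * ((Fintype.card I).factorial : ℝ) ^ 2 ≤
      ((univ.filter (fun p : Equiv.Perm I × Equiv.Perm I =>
        ∀ i, mixedRow z σ (p.1 i) (p.2 i) ∈ E)).card : ℝ) := by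
    intro σ hσ
    simp only [hbad, mem_compl, mem_union, mem_biUnion, mem_univ, true_and, not_or, not_exists,
      hbad₁, hbad₂, mem_filter, not_le] at hσ
    have hconv : ∀ Q : I → Prop, (univ.filter (fun j => ¬ Q j)).card < t →
        (1 + κ) / 2 * N ≤ (univ.filter Q).card := by
      intro Q hQ
      rw [ht, Nat.lt_ceil] at hQ
      have h := card_filter_add_card_filter_not (s := (univ : Finset I)) Q
      rw [card_univ] at h
      have h' : ((univ.filter Q).card : ℝ) + (univ.filter (fun j => ¬ Q j)).card = N := by
        rw [hN]
        exact_mod_cast h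
      linarith
    have := pow_mul_factorial_sq_le_card_matchings (fun i j => mixedRow z σ i j ∈ E) κ hκ
      (fun i => by
        have := hconv (fun j => mixedRow z σ i j ∈ E) (Eq.trans_lt (by convert rfl) (hσ.1 i))
        convert this)
      (fun j => by
        have := hconv (fun i => mixedRow z σ i j ∈ E) (Eq.trans_lt (by convert rfl) (hσ.2 j))
        convert this) univ
    rw [card_univ] at this
    convert this using 4
    simp
  have hsum := sum_card_mixedRow_le (I := I) z E
  have hsum' : badᶜ.card * ((κ / 2) ^ Fintype.card I * ((Fintype.card I).factorial : ℝ) ^ 2) ≤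
      ((Fintype.card I).factorial : ℝ) ^ 2 *
        (univ.filter (fun σ : I × C ≃ V => ∀ i, rowSet σ i ∈ E)).card := by
    have h1 := sum_le_sum hper
    rw [sum_const, nsmul_eq_mul] at h1
    refine h1.trans ?_
    refine (sum_le_univ_sum_of_nonneg (fun _ => Nat.cast_nonneg _)).trans ?_
    exact_mod_cast hsum
  have hf : (0 : ℝ) < ((Fintype.card I).factorial : ℝ) ^ 2 := by positivity
  have h5 : badᶜ.card * (κ / 2) ^ Fintype.card I ≤
      ((univ.filter (fun σ : I × C ≃ V => ∀ i, rowSet σ i ∈ E)).card : ℝ) := by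
    refine le_of_mul_le_mul_left ?_ hf
    linarith
  exact le_trans (by gcongr) h5

end Tails

lemma log_factorial_le {n : ℕ} (hn : n ≠ 0) :
    Real.log n.factorial ≤ n * Real.log n - n + Real.log n / 2 + 1 := by
  obtain ⟨m, rfl⟩ := Nat.exists_eq_succ_of_ne_zero hn
  have h1 : Real.log (Stirling.stirlingSeq (m + 1)) ≤ Real.log (Stirling.stirlingSeq 1) :=
    Stirling.log_stirlingSeq'_antitone (Nat.zero_le m)
  rw [Stirling.log_stirlingSeq_formula, Stirling.log_stirlingSeq_formula] at h1
  have hpos : (0 : ℝ) < ((m + 1 : ℕ) : ℝ) := by positivity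
  rw [Real.log_mul two_ne_zero hpos.ne', Real.log_div hpos.ne' (Real.exp_ne_zero 1),
    Real.log_exp] at h1
  simp only [Nat.factorial_one, Nat.cast_one, Real.log_one, mul_one, one_div, Real.log_inv,
    Real.log_exp] at h1
  rw [Nat.succ_eq_add_one]
  linarith

lemma le_log_factorial {n : ℕ} (hn : n ≠ 0) :
    n * Real.log n - n ≤ Real.log n.factorial := by
  have h := Stirling.le_log_factorial_stirling hn
  have h1 : 0 ≤ Real.log n := Real.log_natCast_nonneg n
  have h2 : 0 ≤ Real.log (2 * Real.pi) := Real.log_nonneg (by linarith [Real.pi_gt_three])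
  linarith

lemma exists_floor_pos_and_mul_pow_le {g : ℝ} (hg : 0 < g) (hg1 : g ≤ 1) :
    ∃ N₀ : ℕ, ∀ N : ℕ, N₀ ≤ N →
      0 < ⌊g * N / 8⌋₊ ∧ 4 * (N : ℝ) * (1 - g / 2) ^ ⌊g * N / 8⌋₊ ≤ 1 := by
  have hq0 : 0 ≤ 1 - g / 2 := by linarith
  have h1 : Filter.Tendsto (fun r : ℕ => (64 / g) * ((r : ℝ) * (1 - g / 2) ^ r)) Filter.atTop
      (nhds 0) := by
    simpa using (tendsto_self_mul_const_pow_of_lt_one hq0 (by linarith)).const_mul (64 / g)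
  have h2 : Filter.Tendsto (fun N : ℕ => ⌊g * N / 8⌋₊) Filter.atTop Filter.atTop := by
    refine tendsto_nat_floor_atTop.comp ?_
    exact (tendsto_natCast_atTop_atTop.const_mul_atTop hg).atTop_div_const (by norm_num)
  have h3 := (h2.eventually (h1.eventually (gt_mem_nhds one_pos))).and
    (h2.eventually (Filter.eventually_gt_atTop 0))
  obtain ⟨N₀, hN₀⟩ := Filter.eventually_atTop.1 h3
  refine ⟨N₀, fun N hN => ?_⟩
  obtain ⟨h4, h5⟩ := hN₀ N hN
  refine ⟨h5, le_trans ?_ h4.le⟩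
  set r := ⌊g * N / 8⌋₊ with hr
  have h6 : g * N / 8 < r + 1 := Nat.lt_floor_add_one _
  have h7 : (1 : ℝ) ≤ r := by exact_mod_cast h5
  have h8 : 4 * (N : ℝ) ≤ 64 / g * r := by
    rw [div_mul_eq_mul_div, le_div_iff₀ hg]
    linarith
  calc 4 * (N : ℝ) * (1 - g / 2) ^ r ≤ 64 / g * r * (1 - g / 2) ^ r := by gcongr
    _ = _ := by ring

lemma exp_le_of_factorial_le {N k n : ℕ} (hN : N ≠ 0) (hk : k ≠ 0) (hn : n = N * k) {g P : ℝ}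
    (hg : 0 < g) (hg1 : g ≤ 1)
    (h : (n.factorial : ℝ) / 2 * (g / 2) ^ N ≤ P * (N.factorial * k.factorial ^ N)) :
    Real.exp ((1 - 1 / (k : ℝ)) * n * Real.log n -
      (2 - Real.log (g / 2) + Real.log k.factorial) * n) ≤ P := by
  have hn0 : n ≠ 0 := hn ▸ Nat.mul_ne_zero hN hk
  have hNf : (0 : ℝ) < N.factorial := by positivity
  have hkf : (0 : ℝ) < k.factorial := by positivity
  have hnf : (0 : ℝ) < n.factorial := by positivity
  have hlhs : 0 < (n.factorial : ℝ) / 2 * (g / 2) ^ N := by positivity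
  have hP : 0 < P := by
    have := hlhs.trans_le h
    exact pos_of_mul_pos_left this (by positivity)
  have hl := Real.log_le_log hlhs h
  rw [Real.log_mul (by positivity) (by positivity), Real.log_div (by positivity) two_ne_zero,
    Real.log_pow, Real.log_mul hP.ne' (by positivity), Real.log_mul hNf.ne' (by positivity),
    Real.log_pow] at hl
  rw [← Real.le_log_iff_exp_le hP]
  have hNn : N ≤ n := hn ▸ Nat.le_mul_of_pos_right N (Nat.pos_of_ne_zero hk)
  have hNn' : (N : ℝ) ≤ n := by exact_mod_cast hNn
  have hN0 : (0 : ℝ) < N := by exact_mod_cast Nat.pos_of_ne_zero hN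
  have h1n : (1 : ℝ) ≤ n := by exact_mod_cast Nat.one_le_iff_ne_zero.2 hn0
  have hlogN : Real.log N.factorial ≤ N * Real.log n := by
    have h1 : (N.factorial : ℝ) ≤ (n : ℝ) ^ N := by
      exact_mod_cast (Nat.factorial_le_pow N).trans (Nat.pow_le_pow_left hNn N)
    have := Real.log_le_log hNf h1
    rwa [Real.log_pow] at this
  have hlogn := le_log_factorial hn0
  have hlog2 : Real.log 2 ≤ 1 := by linarith [Real.log_two_lt_d9]
  have hlogg : Real.log (g / 2) ≤ 0 := Real.log_nonpos (by positivity) (by linarith)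
  have hlogk : 0 ≤ Real.log k.factorial := Real.log_natCast_nonneg _
  have e : (1 - 1 / (k : ℝ)) * n = n - N := by
    have : (k : ℝ) ≠ 0 := by exact_mod_cast hk
    rw [hn]
    push_cast
    field_simp
  rw [e]
  have e1 := mul_nonneg (sub_nonneg.2 hNn') (neg_nonneg.2 hlogg)
  have e2 := mul_nonneg (sub_nonneg.2 hNn') hlogk
  linarith

lemma le_exp_of_mul_le_factorial {N k n : ℕ} (hN : N ≠ 0) (hk : 2 ≤ k) (hn : n = N * k)
    (hlarge : Real.log n / 2 + 1 ≤ n / 4) {P : ℝ} (hP0 : 0 ≤ P)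
    (h : P * (N.factorial * k.factorial ^ N) ≤ n.factorial) :
    P ≤ Real.exp ((1 - 1 / (k : ℝ)) * n * Real.log n - 1 / 4 * n) := by
  rcases hP0.eq_or_lt with rfl | hP
  · positivity
  have hk0 : k ≠ 0 := by omega
  have hn0 : n ≠ 0 := hn ▸ Nat.mul_ne_zero hN hk0
  have hNf : (0 : ℝ) < N.factorial := by positivity
  have hkf : (0 : ℝ) < k.factorial := by positivity
  have hl := Real.log_le_log (by positivity) h
  rw [Real.log_mul hP.ne' (by positivity), Real.log_mul hNf.ne' (by positivity),
    Real.log_pow] at hl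
  rw [← Real.log_le_iff_le_exp hP]
  have hN0 : (0 : ℝ) < N := by exact_mod_cast Nat.pos_of_ne_zero hN
  have hkR : (2 : ℝ) ≤ k := by exact_mod_cast hk
  have hnR : (n : ℝ) = N * k := by exact_mod_cast hn
  have h1 := log_factorial_le hn0
  have h2 := le_log_factorial hN
  have h3 : Real.log k ≤ Real.log k.factorial :=
    Real.log_le_log (by positivity) (by exact_mod_cast Nat.self_le_factorial k)
  have h4 : Real.log n = Real.log N + Real.log k := by
    rw [hnR, Real.log_mul hN0.ne' (by positivity)]
  have e : (1 - 1 / (k : ℝ)) * n = n - N := by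
    rw [hnR]
    field_simp
  rw [e]
  have h5 := mul_le_mul_of_nonneg_left h3 hN0.le
  have h6 : (N : ℝ) * Real.log n = N * Real.log N + N * Real.log k := by rw [h4]; ring
  have h7 : 2 * (N : ℝ) ≤ n := by
    rw [hnR, mul_comm]
    gcongr
  linarith

open Finset in
lemma eventually_le_card_rows_mem {g : ℝ} (hg : 0 < g) (hg1 : g ≤ 1 / 4) :
    ∃ N₀ : ℕ, ∀ N k n : ℕ, N₀ ≤ N → 2 ≤ k → n = N * k → ∀ E : Finset (Finset (Fin n)),
      (∀ S : Finset (Fin n), S.card = k - 1 →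
        ((univ.filter (fun x => insert x S ∉ E)).card : ℝ) ≤ (1 / 2 - g) * n) →
      (n.factorial : ℝ) / 2 * (g / 2) ^ N ≤
        (univ.filter (fun σ : Fin N × Fin k ≃ Fin n => ∀ i, rowSet σ i ∈ E)).card := by
  obtain ⟨N₀, hN₀⟩ := exists_floor_pos_and_mul_pow_le hg (by linarith)
  refine ⟨N₀, fun N k n hN hk hn E hE => ?_⟩
  obtain ⟨hr, hsmall⟩ := hN₀ N hN
  set r := ⌊g * N / 8⌋₊ with hrdef
  set t := ⌈(1 - g) / 2 * (N : ℝ)⌉₊ with htdef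
  have hN0 : 0 ≤ (N : ℝ) := Nat.cast_nonneg N
  have hrle : (r : ℝ) ≤ g * N / 8 := Nat.floor_le (by positivity)
  have hr1 : (1 : ℝ) ≤ r := by exact_mod_cast hr
  have hNpos : 0 < (N : ℝ) := by
    rcases hN0.eq_or_lt with h | h
    · rw [← h] at hrle
      linarith
    · exact h
  have hgN : g * N ≤ 1 / 4 * N := by gcongr
  have htge : (1 - g) / 2 * (N : ℝ) ≤ t := Nat.le_ceil _
  have hrN : r ≤ N := by
    have : (r : ℝ) ≤ N := by linarith
    exact_mod_cast this
  have hrt : r ≤ t + 1 := by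
    have : (r : ℝ) ≤ t + 1 := by linarith
    exact_mod_cast this
  have hkR : (2 : ℝ) ≤ k := by exact_mod_cast hk
  have hnR : (n : ℝ) = N * k := by exact_mod_cast hn
  have ha : (1 / 2 - 5 * g / 8) * N ≤ ((t + 1 - r : ℕ) : ℝ) := by
    rw [Nat.cast_sub hrt]
    push_cast
    linarith
  have hb : (1 - g / 8) * (k * N) ≤ ((k * (N - r) : ℕ) : ℝ) := by
    rw [Nat.cast_mul, Nat.cast_sub hrN]
    have := mul_le_mul_of_nonneg_left hrle (by linarith : (0 : ℝ) ≤ k)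
    linarith
  have ha0 : 0 < (1 / 2 - 5 * g / 8) * (N : ℝ) := mul_pos (by linarith) hNpos
  have hb0 : 0 < (1 - g / 8) * (k * (N : ℝ)) := mul_pos (by linarith) (by positivity)
  have hcard : Fintype.card (Fin N × Fin k ≃ Fin n) = n.factorial := by
    rw [Fintype.card_equiv (finProdFinEquiv.trans (finCongr hn.symm)), Fintype.card_prod,
      Fintype.card_fin, Fintype.card_fin, hn]
  have key := le_card_rows_mem (I := Fin N) (C := Fin k) (V := Fin n) (z := ⟨0, by omega⟩)
    (o := ⟨1, by omega⟩) (by simp) (E := E) (d := (1 / 2 - g) * n)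
    (mul_nonneg (by linarith) (Nat.cast_nonneg n))
    (by
      rw [Fintype.card_fin]
      intro S hS
      convert hE S hS)
    (κ := g) hg.le (t := t) (r := r) (m := k * (N - r)) (q := 1 - g / 2) hr
    (by rw [Fintype.card_fin])
    (by
      rw [Fintype.card_fin, Fintype.card_fin, ← mul_add, Nat.sub_add_cancel hrN, mul_comm])
    (mul_pos (ha0.trans_le ha) (hb0.trans_le hb))
    (by
      rw [Fintype.card_fin, hnR]
      have h1 := mul_le_mul ha hb hb0.le (ha0.le.trans ha)
      have h2 := mul_le_mul_of_nonneg_left h1 (by linarith : 0 ≤ 1 - g / 2)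
      refine le_trans ?_ h2
      have h3 : 1 / 2 - g ≤ (1 - g / 2) * ((1 / 2 - 5 * g / 8) * (1 - g / 8)) := by
        nlinarith [mul_nonneg hg.le hg.le, mul_nonneg (mul_nonneg hg.le hg.le) hg.le]
      have h4 := mul_le_mul_of_nonneg_right h3 (by positivity : 0 ≤ (N : ℝ) * (N * k))
      linarith)
    (by rw [Fintype.card_fin]; exact hsmall)
  rw [hcard, Fintype.card_fin] at key
  convert key

/-- For every integer `k ≥ 2` and every `γ > 0` there exist constants `c₁, c₂ > 0` and
`n₀` such that for all `n ≥ n₀` with `k ∣ n`, every `k`-graph on `n` vertices with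
minimum codegree at least `(1/2 + γ)n` contains at least `exp((1 − 1/k) n ln n − c₂ n)`
and at most `exp((1 − 1/k) n ln n − c₁ n)` perfect matchings. -/
theorem stmt_1 :
    ∀ k : ℕ, 2 ≤ k → ∀ γ : ℝ, 0 < γ →
    ∃ c₁ c₂ : ℝ, 0 < c₁ ∧ 0 < c₂ ∧ ∃ n₀ : ℕ, ∀ n : ℕ, n₀ ≤ n → k ∣ n →
    ∀ E : Finset (Finset (Fin n)),
      (∀ e ∈ E, e.card = k) →
      (∀ S : Finset (Fin n), S.card = k - 1 →
        (1/2 + γ) * (n : ℝ) ≤ ((E.filter (fun e => S ⊆ e)).card : ℝ)) →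
      Real.exp ((1 - 1/(k : ℝ)) * n * Real.log n - c₂ * n) ≤
        ((perfectMatchings n E).card : ℝ) ∧
      ((perfectMatchings n E).card : ℝ) ≤
        Real.exp ((1 - 1/(k : ℝ)) * n * Real.log n - c₁ * n) := by
  intro k hk γ hγ
  have hk0 : 0 < k := by omega
  set g := min γ (1 / 4) with hg
  have hg0 : 0 < g := lt_min hγ (by norm_num)
  have hg1 : g ≤ 1 / 4 := min_le_right _ _
  obtain ⟨N₀, hN₀⟩ := eventually_le_card_rows_mem hg0 hg1
  have hlog : ∀ᶠ n : ℕ in Filter.atTop, Real.log n / 2 + 1 ≤ n / 4 := by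
    have h1 := (Real.isLittleO_log_id_atTop.comp_tendsto tendsto_natCast_atTop_atTop).bound
      (show (0 : ℝ) < 1 / 4 by norm_num)
    filter_upwards [h1, Filter.eventually_ge_atTop 8] with n h2 h3
    have h4 : (8 : ℝ) ≤ n := by exact_mod_cast h3
    simp only [Function.comp_apply, id, Real.norm_eq_abs, Nat.abs_cast] at h2
    linarith [le_abs_self (Real.log n)]
  obtain ⟨n₁, hn₁⟩ := Filter.eventually_atTop.1 hlog
  have hlogg : Real.log (g / 2) ≤ 0 := Real.log_nonpos (by positivity) (by linarith)
  have hlogk : 0 ≤ Real.log k.factorial := Real.log_natCast_nonneg _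
  refine ⟨1 / 4, 2 - Real.log (g / 2) + Real.log k.factorial, by norm_num, by linarith,
    max n₁ ((N₀ + 1) * k), fun n hn hkn E hE hdeg => ?_⟩
  obtain ⟨N, hN⟩ := hkn
  have hnN : n = N * k := by rw [hN, mul_comm]
  have hNN : N₀ + 1 ≤ N := by
    have h := (le_max_right _ _).trans hn
    rw [hnN] at h
    exact Nat.le_of_mul_le_mul_right h hk0
  have hcod : ∀ S : Finset (Fin n), S.card = k - 1 →
      ((Finset.univ.filter (fun x => insert x S ∉ E)).card : ℝ) ≤ (1 / 2 - g) * n := by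
    intro S hS
    have h := card_insert_notMem_le (γ := g) hk0 hE hS (by
      rw [Fintype.card_fin]
      refine le_trans ?_ ((hdeg S hS).trans_eq ?_)
      · have := min_le_left γ (1 / 4)
        gcongr
      · congr)
    rw [Fintype.card_fin] at h
    convert h
  have hrows := hN₀ N k n (by omega) hk hnN E (by
    intro S hS
    convert hcod S hS)
  have hcount := card_rows_mem_eq hk0 hnN hE
  constructor
  · refine exp_le_of_factorial_le (N := N) (by omega) (by omega) hnN hg0 (by linarith)
      (hrows.trans_eq ?_)
    rw [hcount]
    push_cast
    ring
  · refine le_exp_of_mul_le_factorial (N := N) (by omega) hk hnN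
      (hn₁ n ((le_max_left _ _).trans hn)) (Nat.cast_nonneg _) ?_
    have h1 := Finset.card_le_univ
      (Finset.univ.filter (fun σ : Fin N × Fin k ≃ Fin n => ∀ i, rowSet σ i ∈ E))
    rw [hcount, Fintype.card_equiv (finProdFinEquiv.trans (finCongr hnN.symm)),
      Fintype.card_prod, Fintype.card_fin, Fintype.card_fin, ← hnN] at h1
    exact_mod_cast h1
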